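/- Under Conditions (C1)–(C6), for every integer m ≥ 1 and every choice of 0 < u_1 < u_2 < … < u_m < 1, the random vector (Z_diff^π(⌊n·u_1⌋), …, Z_diff^π(⌊n·u_m⌋)) under the permutation null distribution converges in distribution, as n → ∞, to a centered m-dimensional Gaussian random vector with covariance matrix C given by C_{ij} = ρ_diff*(u_i, u_j) (a positive definite matrix with unit diagonal). -/

import Mathlib

open Finset Filter Asymptotics MeasureTheory ProbabilityTheory Topology

namespace RING

/-- `U1^π(t1,t2)`: sum of `R (π i) (π j)` over indices (1-based `i,j ∈ {1,…,n}`,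
represented by `Fin n` with `i` standing for index `i+1`) with `t1 < i ≤ t2` and
`t1 < j ≤ t2`. -/
noncomputable def U1 (n : ℕ) (R : Fin n → Fin n → ℝ) (π : Equiv.Perm (Fin n))
    (t1 t2 : ℕ) : ℝ :=
  ∑ i : Fin n, ∑ j : Fin n,
    if t1 ≤ (i : ℕ) ∧ (i : ℕ) < t2 ∧ t1 ≤ (j : ℕ) ∧ (j : ℕ) < t2 then R (π i) (π j) else 0

/-- `U2^π(t1,t2)`: sum of `R (π i) (π j)` over indices with `i ≤ t1` or `i > t2`,
and `j ≤ t1` or `j > t2`. -/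
noncomputable def U2 (n : ℕ) (R : Fin n → Fin n → ℝ) (π : Equiv.Perm (Fin n))
    (t1 t2 : ℕ) : ℝ :=
  ∑ i : Fin n, ∑ j : Fin n,
    if ((i : ℕ) < t1 ∨ t2 ≤ (i : ℕ)) ∧ ((j : ℕ) < t1 ∨ t2 ≤ (j : ℕ)) then R (π i) (π j) else 0

/-- Expectation under the permutation null distribution (uniform over all `n!`
permutations). -/
noncomputable def pexp (n : ℕ) (f : Equiv.Perm (Fin n) → ℝ) : ℝ :=
  (∑ π : Equiv.Perm (Fin n), f π) / (Nat.factorial n)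

/-- Variance under the permutation null distribution. -/
noncomputable def pvar (n : ℕ) (f : Equiv.Perm (Fin n) → ℝ) : ℝ :=
  pexp n (fun π => (f π - pexp n f) ^ 2)

/-- Covariance under the permutation null distribution. -/
noncomputable def pcov (n : ℕ) (f g : Equiv.Perm (Fin n) → ℝ) : ℝ :=
  pexp n (fun π => (f π - pexp n f) * (g π - pexp n g))

/-- `R̄_{i·} = (Σ_j R_{ij})/(n-1)`. -/
noncomputable def Rbar (n : ℕ) (R : Fin n → Fin n → ℝ) (i : Fin n) : ℝ :=
  (∑ j : Fin n, R i j) / ((n : ℝ) - 1)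

/-- `r0 = (1/n) Σ_i R̄_{i·}`. -/
noncomputable def r0 (n : ℕ) (R : Fin n → Fin n → ℝ) : ℝ :=
  (∑ i : Fin n, Rbar n R i) / n

/-- `r1² = (1/n) Σ_i R̄_{i·}²`. -/
noncomputable def r1sq (n : ℕ) (R : Fin n → Fin n → ℝ) : ℝ :=
  (∑ i : Fin n, (Rbar n R i) ^ 2) / n

/-- `r_d² = (1/(n(n-1))) Σ_i Σ_j R_{ij}²`. -/
noncomputable def rdsq (n : ℕ) (R : Fin n → Fin n → ℝ) : ℝ :=
  (∑ i : Fin n, ∑ j : Fin n, (R i j) ^ 2) / ((n : ℝ) * ((n : ℝ) - 1))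

/-- `U_diff^π = U1^π − U2^π`. -/
noncomputable def Udiff (n : ℕ) (R : Fin n → Fin n → ℝ) (π : Equiv.Perm (Fin n))
    (t1 t2 : ℕ) : ℝ :=
  U1 n R π t1 t2 - U2 n R π t1 t2

/-- `U_w^π = ((n−t2+t1−1)·U1^π + (t2−t1−1)·U2^π)/(n−2)`. -/
noncomputable def Uw (n : ℕ) (R : Fin n → Fin n → ℝ) (π : Equiv.Perm (Fin n))
    (t1 t2 : ℕ) : ℝ :=
  (((n : ℝ) - t2 + t1 - 1) * U1 n R π t1 t2 + ((t2 : ℝ) - t1 - 1) * U2 n R π t1 t2) /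
    ((n : ℝ) - 2)

/-- Standardized `Z_w^π(t1,t2)`. -/
noncomputable def Zw (n : ℕ) (R : Fin n → Fin n → ℝ) (π : Equiv.Perm (Fin n))
    (t1 t2 : ℕ) : ℝ :=
  (Uw n R π t1 t2 - pexp n (fun σ => Uw n R σ t1 t2)) /
    Real.sqrt (pvar n (fun σ => Uw n R σ t1 t2))

/-- Standardized `Z_diff^π(t1,t2)`. -/
noncomputable def Zdiff (n : ℕ) (R : Fin n → Fin n → ℝ) (π : Equiv.Perm (Fin n))
    (t1 t2 : ℕ) : ℝ :=
  (Udiff n R π t1 t2 - pexp n (fun σ => Udiff n R σ t1 t2)) /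
    Real.sqrt (pvar n (fun σ => Udiff n R σ t1 t2))

/-- Discrete σ-algebra on the finite permutation group. -/
instance (n : ℕ) : MeasurableSpace (Equiv.Perm (Fin n)) := ⊤

/-- The permutation null distribution: the uniform probability measure on the
`n!` permutations of `{1,…,n}`. -/
noncomputable def permP (n : ℕ) : ProbabilityMeasure (Equiv.Perm (Fin n)) :=
  ⟨(PMF.uniformOfFintype (Equiv.Perm (Fin n))).toMeasure,
    PMF.toMeasure.isProbabilityMeasure _⟩

/-- The distribution of a real-valued statistic under the permutation null
distribution. -/
noncomputable def permDist (n : ℕ) (f : Equiv.Perm (Fin n) → ℝ) : ProbabilityMeasure ℝ :=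
  (permP n).map (f := f) (Measurable.aemeasurable (fun _ _ => trivial))

/-- The centered Gaussian distribution on `ℝ` with variance `v` (for `v ≥ 0`). -/
noncomputable def gaussLimit (v : ℝ) : ProbabilityMeasure ℝ :=
  ⟨gaussianReal 0 (Real.toNNReal v), inferInstance⟩

/-- `ρ_w*(u,v) = (u∧v)(1−(u∨v))/((u∨v)(1−(u∧v)))`. -/
noncomputable def rhoW (u v : ℝ) : ℝ :=
  (min u v * (1 - max u v)) / (max u v * (1 - min u v))

/-- `ρ_diff*(u,v) = (u∧v)(1−(u∨v))/√((u∧v)(1−(u∧v))·(u∨v)(1−(u∨v)))`. -/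
noncomputable def rhoDiff (u v : ℝ) : ℝ :=
  (min u v * (1 - max u v)) /
    Real.sqrt (min u v * (1 - min u v) * (max u v * (1 - max u v)))

/-- Condition (C1): `Σ_i (Σ_j R_{ij}²)² = O(n³ r_d⁴)`. -/
def Cond1 (R : (n : ℕ) → Fin n → Fin n → ℝ) : Prop :=
  (fun n => ∑ i : Fin n, (∑ j : Fin n, (R n i j) ^ 2) ^ 2)
    =O[atTop] fun n => (n : ℝ) ^ 3 * (rdsq n (R n)) ^ 2

/-- Condition (C2): `Σ_i |R̄_{i·} − r0|³ = o((n(r1² − r0²))^{3/2})`. -/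
def Cond2 (R : (n : ℕ) → Fin n → Fin n → ℝ) : Prop :=
  (fun n => ∑ i : Fin n, |Rbar n (R n) i - r0 n (R n)| ^ 3)
    =o[atTop] fun n => ((n : ℝ) * (r1sq n (R n) - (r0 n (R n)) ^ 2)) ^ ((3 : ℝ) / 2)

/-- Condition (C3): `Σ_i (R̄_{i·} − r0)³ = o(n·r_d·(r1² − r0²))`. -/
def Cond3 (R : (n : ℕ) → Fin n → Fin n → ℝ) : Prop :=
  (fun n => ∑ i : Fin n, (Rbar n (R n) i - r0 n (R n)) ^ 3)
    =o[atTop] fun n =>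
      (n : ℝ) * Real.sqrt (rdsq n (R n)) * (r1sq n (R n) - (r0 n (R n)) ^ 2)

/-- Condition (C4): `|Σ_{i≠j≠k} R_{ji} R_{ik} (R̄_{j·} − r0)(R̄_{k·} − r0)| =
o(n³ r_d² (r1² − r0²))`. -/
def Cond4 (R : (n : ℕ) → Fin n → Fin n → ℝ) : Prop :=
  (fun n =>
      |∑ i : Fin n, ∑ j : Fin n, ∑ k : Fin n,
        if i ≠ j ∧ i ≠ k ∧ j ≠ k then
          R n j i * R n i k * (Rbar n (R n) j - r0 n (R n)) * (Rbar n (R n) k - r0 n (R n))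
        else 0|)
    =o[atTop] fun n => (n : ℝ) ^ 3 * rdsq n (R n) * (r1sq n (R n) - (r0 n (R n)) ^ 2)

/-- Condition (C5): `Σ_i Σ_j Σ_{k∉{i,j}} Σ_{l∉{i,j}} R_{ij} R_{kl}
(R_{ik} R_{jl} + R_{il} R_{jk}) = o(n⁴ r_d⁴)`. -/
def Cond5 (R : (n : ℕ) → Fin n → Fin n → ℝ) : Prop :=
  (fun n =>
      ∑ i : Fin n, ∑ j : Fin n, ∑ k : Fin n, ∑ l : Fin n,
        if k ≠ i ∧ k ≠ j ∧ l ≠ i ∧ l ≠ j then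
          R n i j * R n k l * (R n i k * R n j l + R n i l * R n j k)
        else 0)
    =o[atTop] fun n => (n : ℝ) ^ 4 * (rdsq n (R n)) ^ 2

/-- Condition (C6): `r1 = o(r_d)`. -/
def Cond6 (R : (n : ℕ) → Fin n → Fin n → ℝ) : Prop :=
  (fun n => Real.sqrt (r1sq n (R n))) =o[atTop] fun n => Real.sqrt (rdsq n (R n))

end RING

namespace RING

section LinearStatistic

/-- The linear permutation statistic `Σ_i a_i y_{π(i)}`. -/
noncomputable def permSum {n : ℕ} (a y : Fin n → ℝ) (π : Equiv.Perm (Fin n)) : ℝ :=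
  ∑ i, a i * y (π i)

/-- The increment of `permSum a y` when `π` is replaced by `π * swap i j`. -/
noncomputable def swapDiff {n : ℕ} (a y : Fin n → ℝ) (π : Equiv.Perm (Fin n)) (i j : Fin n) : ℝ :=
  (a i - a j) * (y (π j) - y (π i))

variable {n : ℕ} {a y : Fin n → ℝ}

lemma permSum_mul_swap (a y : Fin n → ℝ) (π : Equiv.Perm (Fin n)) (i j : Fin n) :
    permSum a y (π * Equiv.swap i j) = permSum a y π + swapDiff a y π i j := by
  rcases eq_or_ne i j with rfl | hij
  · rw [Equiv.swap_self, ← Equiv.Perm.one_def, mul_one]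
    simp [swapDiff]
  · have hji : j ∈ univ.erase i := by simp [hij.symm]
    unfold permSum swapDiff
    rw [← add_sum_erase _ _ (mem_univ i), ← add_sum_erase _ _ hji,
      ← add_sum_erase (univ) (fun i => a i * y (π i)) (mem_univ i),
      ← add_sum_erase _ (fun i => a i * y (π i)) hji]
    have : ∑ k ∈ (univ.erase i).erase j, a k * y ((π * Equiv.swap i j) k)
        = ∑ k ∈ (univ.erase i).erase j, a k * y (π k) := by
      refine sum_congr rfl fun k hk => ?_
      simp only [mem_erase, mem_univ, and_true] at hk
      simp [Equiv.swap_apply_of_ne_of_ne hk.2 hk.1]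
    rw [this]
    simp
    ring

lemma swapDiff_mul_swap (a y : Fin n → ℝ) (π : Equiv.Perm (Fin n)) (i j : Fin n) :
    swapDiff a y (π * Equiv.swap i j) i j = -swapDiff a y π i j := by
  simp [swapDiff]
  ring

lemma sum_comp_perm (h : Fin n → ℝ) (π : Equiv.Perm (Fin n)) : ∑ i, h (π i) = ∑ i, h i :=
  Equiv.sum_comp π h

lemma sum_swapDiff (hy : ∑ i, y i = 0) (π : Equiv.Perm (Fin n)) :
    ∑ i, ∑ j, swapDiff a y π i j = -2 * n * permSum a y π := by
  have hy' : ∑ i, y (π i) = 0 := by rw [sum_comp_perm, hy]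
  have h : ∀ i j, swapDiff a y π i j
      = a i * y (π j) - (a i * y (π i)) * 1 - a j * y (π j) + a j * y (π i) := by
    intro i j; unfold swapDiff; ring
  simp only [h, sum_add_distrib, sum_sub_distrib, ← mul_sum, ← sum_mul, hy', sum_const,
    card_univ, Fintype.card_fin, nsmul_eq_mul, permSum]
  ring

lemma sum_swapDiff_sq (ha : ∑ i, a i = 0) (hy : ∑ i, y i = 0) (π : Equiv.Perm (Fin n)) :
    ∑ i, ∑ j, swapDiff a y π i j ^ 2
      = 2 * n * permSum (fun i => a i ^ 2) (fun i => y i ^ 2) π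
        + 2 * (∑ i, a i ^ 2) * (∑ i, y i ^ 2) + 4 * permSum a y π ^ 2 := by
  have hy' : ∑ i, y (π i) = 0 := by rw [sum_comp_perm, hy]
  have hy2 : ∑ i, y (π i) ^ 2 = ∑ i, y i ^ 2 := sum_comp_perm (fun i => y i ^ 2) π
  have h : ∀ i j, swapDiff a y π i j ^ 2
      = a i ^ 2 * y (π j) ^ 2 + (a i ^ 2 * y (π i) ^ 2) * 1 - 2 * (a i ^ 2 * y (π i)) * y (π j)
        + a j ^ 2 * y (π j) ^ 2 + y (π i) ^ 2 * a j ^ 2 - 2 * y (π i) * (a j ^ 2 * y (π j))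
        - 2 * a i * (a j * y (π j) ^ 2) - 2 * (a i * y (π i) ^ 2) * a j
        + 4 * (a i * y (π i)) * (a j * y (π j)) := by
    intro i j; unfold swapDiff; ring
  simp only [h, sum_add_distrib, sum_sub_distrib, ← mul_sum, ← sum_mul, hy', hy2, ha, sum_const,
    card_univ, Fintype.card_fin, nsmul_eq_mul, permSum]
  ring

/-- Exchangeability of `(π, π * swap i j)`. -/
lemma sum_swapDiff_mul (f : ℝ → ℂ) (i j : Fin n) :
    ∑ π, (swapDiff a y π i j : ℂ) * f (permSum a y π + swapDiff a y π i j)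
      = -∑ π, (swapDiff a y π i j : ℂ) * f (permSum a y π) := by
  rw [← Equiv.sum_comp (Equiv.mulRight (Equiv.swap i j)), ← sum_neg_distrib]
  refine sum_congr rfl fun π _ => ?_
  simp only [Equiv.coe_mulRight]
  rw [swapDiff_mul_swap, permSum_mul_swap]
  simp

/-- The Stein identity for the exchangeable pair given by a random transposition. -/
lemma stein_identity (hy : ∑ i, y i = 0) (f : ℝ → ℂ) :
    4 * n * ∑ π, (permSum a y π : ℂ) * f (permSum a y π)
      = ∑ π, ∑ i, ∑ j, (swapDiff a y π i j : ℂ)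
          * (f (permSum a y π + swapDiff a y π i j) - f (permSum a y π)) := by
  have h1 : ∑ π, ∑ i, ∑ j, (swapDiff a y π i j : ℂ) * f (permSum a y π)
      = -2 * n * ∑ π, (permSum a y π : ℂ) * f (permSum a y π) := by
    rw [mul_sum]
    refine sum_congr rfl fun π _ => ?_
    simp only [← sum_mul]
    have := congrArg (fun r : ℝ => (r : ℂ)) (sum_swapDiff (a := a) hy π)
    push_cast at this
    rw [this]
    ring
  have h2 : ∑ π, ∑ i, ∑ j, (swapDiff a y π i j : ℂ)
        * f (permSum a y π + swapDiff a y π i j)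
      = -∑ π, ∑ i, ∑ j, (swapDiff a y π i j : ℂ) * f (permSum a y π) := by
    rw [sum_comm, sum_comm (s := univ) (t := univ) (f := fun π i => ∑ j, _ * f (permSum a y π)),
      ← sum_neg_distrib]
    refine sum_congr rfl fun i _ => ?_
    rw [sum_comm, sum_comm (s := univ) (t := univ) (f := fun π j => _ * f (permSum a y π)),
      ← sum_neg_distrib]
    exact sum_congr rfl fun j _ => sum_swapDiff_mul f i j
  simp only [mul_sub, sum_sub_distrib]
  rw [h2, h1]
  ring

lemma pexp_add (f g : Equiv.Perm (Fin n) → ℝ) :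
    pexp n (fun π => f π + g π) = pexp n f + pexp n g := by
  simp [pexp, sum_add_distrib, add_div]

lemma pexp_const_mul (c : ℝ) (f : Equiv.Perm (Fin n) → ℝ) :
    pexp n (fun π => c * f π) = c * pexp n f := by
  simp [pexp, ← mul_sum, mul_div_assoc]

lemma pexp_const (c : ℝ) : pexp n (fun _ => c) = c := by
  have : (n.factorial : ℝ) ≠ 0 := by positivity
  simp [pexp, Fintype.card_perm, this]

/-- The expectation of the absolute value is bounded by the root of the second moment. -/
lemma pexp_abs_le_sqrt (f : Equiv.Perm (Fin n) → ℝ) :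
    pexp n (fun π => |f π|) ≤ √(pexp n (fun π => f π ^ 2)) := by
  apply Real.le_sqrt_of_sq_le
  have hN : (0 : ℝ) < n.factorial := by positivity
  have h := sq_sum_le_card_mul_sum_sq (s := (univ : Finset (Equiv.Perm (Fin n))))
    (f := fun π => |f π|)
  simp only [card_univ, Fintype.card_perm, Fintype.card_fin, sq_abs] at h
  unfold pexp
  rw [div_pow, div_le_div_iff₀ (by positivity) hN]
  nlinarith

lemma pexp_apply_perm (h : Fin n → ℝ) (i : Fin n) :
    pexp n (fun π => h (π i)) = (∑ k, h k) / n := by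
  have hn : (n : ℝ) ≠ 0 := by
    have := i.pos
    positivity
  have hc : ∀ j, pexp n (fun π => h (π j)) = pexp n (fun π => h (π i)) := by
    intro j
    unfold pexp
    rw [← Equiv.sum_comp (Equiv.mulRight (Equiv.swap i j))]
    simp
  have hs : ∑ j, pexp n (fun π => h (π j)) = ∑ k, h k := by
    unfold pexp
    rw [← sum_div, sum_comm]
    simp only [sum_comp_perm]
    exact pexp_const _
  simp only [hc, sum_const, card_univ, Fintype.card_fin, nsmul_eq_mul] at hs
  field_simp
  linarith

lemma pexp_permSum (a y : Fin n → ℝ) :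
    pexp n (permSum a y) = (∑ i, a i) * (∑ i, y i) / n := by
  have : pexp n (permSum a y) = ∑ i, a i * pexp n (fun π => y (π i)) := by
    unfold permSum pexp
    rw [sum_comm, sum_div]
    refine sum_congr rfl fun i _ => ?_
    rw [← mul_sum, mul_div_assoc]
  simp only [this, pexp_apply_perm, ← sum_mul, mul_div_assoc]

lemma permSum_sub_const (hy : ∑ i, y i = 0) (c : ℝ) (π : Equiv.Perm (Fin n)) :
    permSum (fun i => a i - c) y π = permSum a y π := by
  simp [permSum, sub_mul, sum_sub_distrib, ← mul_sum, sum_comp_perm, hy]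

/-- The second moment of a centered linear permutation statistic. -/
lemma pexp_permSum_sq (hn : 2 ≤ n) (ha : ∑ i, a i = 0) (hy : ∑ i, y i = 0) :
    pexp n (fun π => permSum a y π ^ 2) = (∑ i, a i ^ 2) * (∑ i, y i ^ 2) / (n - 1) := by
  have hn' : (2 : ℝ) ≤ n := by exact_mod_cast hn
  have h := stein_identity (a := a) hy (fun w => (w : ℂ))
  have h2 : 4 * n * ∑ π, permSum a y π ^ 2 = ∑ π, ∑ i, ∑ j, swapDiff a y π i j ^ 2 := by
    have : ((4 * n * ∑ π, permSum a y π ^ 2 : ℝ) : ℂ)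
        = ((∑ π, ∑ i, ∑ j, swapDiff a y π i j ^ 2 : ℝ) : ℂ) := by
      push_cast
      simpa [sq] using h
    exact_mod_cast this
  have h3 : 4 * n * pexp n (fun π => permSum a y π ^ 2)
      = pexp n (fun π => ∑ i, ∑ j, swapDiff a y π i j ^ 2) := by
    unfold pexp
    rw [← h2, mul_div_assoc]
  simp only [sum_swapDiff_sq ha hy, pexp_add, pexp_const_mul, pexp_const] at h3
  rw [show pexp n (fun π => permSum (fun i => a i ^ 2) (fun i => y i ^ 2) π) = _ from
    pexp_permSum _ _] at h3
  have : (n : ℝ) - 1 ≠ 0 := by linarith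
  have hn0 : (n : ℝ) ≠ 0 := by linarith
  field_simp at h3 ⊢
  linarith

lemma pexp_permSum_sq_le (hn : 2 ≤ n) (hy : ∑ i, y i = 0) :
    pexp n (fun π => permSum a y π ^ 2) ≤ (∑ i, a i ^ 2) * (∑ i, y i ^ 2) / (n - 1) := by
  have hn' : (2 : ℝ) ≤ n := by exact_mod_cast hn
  set c := (∑ i, a i) / n with hc
  have hcn : ∑ i, a i = n * c := by rw [hc]; field_simp
  have h0 : ∑ i, (a i - c) = 0 := by simp [sum_sub_distrib, hcn]
  have h := pexp_permSum_sq hn h0 hy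
  simp only [permSum_sub_const hy] at h
  rw [h]
  have : 0 ≤ (n : ℝ) - 1 := by linarith
  gcongr ?_ * _ / _
  have : ∑ i, (a i - c) ^ 2 = ∑ i, a i ^ 2 - n * c ^ 2 := by
    simp only [sub_sq, sum_add_distrib, sum_sub_distrib, ← mul_sum, ← sum_mul, hcn, sum_const,
      card_univ, Fintype.card_fin, nsmul_eq_mul]
    ring
  rw [this]
  have : 0 ≤ n * c ^ 2 := by positivity
  linarith

lemma norm_exp_mul_I_sub_le (x : ℝ) : ‖Complex.exp (x * Complex.I) - 1 - x * Complex.I‖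
    ≤ 2 * x ^ 2 := by
  have hx : ‖(x * Complex.I : ℂ)‖ = |x| := by simp
  rcases le_total |x| 1 with h | h
  · have := Complex.norm_exp_sub_one_sub_id_le (x := x * Complex.I) (by rwa [hx])
    rw [hx, sq_abs] at this
    nlinarith [sq_nonneg x]
  · have h1 := norm_sub_le (Complex.exp (x * Complex.I) - 1) (x * Complex.I)
    have h2 := Real.norm_exp_I_mul_ofReal_sub_one_le (x := x)
    rw [mul_comm, Real.norm_eq_abs] at h2
    rw [hx] at h1
    nlinarith [sq_abs x]

/-- The characteristic function of `permSum a y` under the permutation null distribution. -/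
noncomputable def permChar {n : ℕ} (a y : Fin n → ℝ) (s : ℝ) : ℂ :=
  (∑ π, Complex.exp ((s * permSum a y π : ℝ) * Complex.I)) / n.factorial

/-- The derivative of `permChar a y`. -/
noncomputable def permCharDeriv {n : ℕ} (a y : Fin n → ℝ) (s : ℝ) : ℂ :=
  (∑ π, Complex.I * (permSum a y π * Complex.exp ((s * permSum a y π : ℝ) * Complex.I)))
    / n.factorial

variable {K : ℝ}

lemma hasDerivAt_permChar (a y : Fin n → ℝ) (s : ℝ) :
    HasDerivAt (permChar a y) (permCharDeriv a y s) s := by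
  unfold permChar permCharDeriv
  refine HasDerivAt.div_const (HasDerivAt.fun_sum fun π _ => ?_) _
  have h1 : HasDerivAt (fun s : ℝ => ((s * permSum a y π : ℝ) : ℂ) * Complex.I)
      (((1 * permSum a y π : ℝ) : ℂ) * Complex.I) s :=
    (((hasDerivAt_id s).mul_const (permSum a y π)).ofReal_comp).mul_const _
  refine h1.cexp.congr_deriv ?_
  push_cast
  ring

lemma sum_abs_swapDiff_cube_le (hK : ∀ i, |a i| ≤ K) (π : Equiv.Perm (Fin n)) :
    ∑ i, ∑ j, |swapDiff a y π i j| ^ 3 ≤ 64 * n * K ^ 3 * ∑ i, |y i| ^ 3 := by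
  have h : ∀ i j, |swapDiff a y π i j| ^ 3
      ≤ 32 * K ^ 3 * (|y (π j)| ^ 3 * 1) + 32 * K ^ 3 * (|y (π i)| ^ 3 * 1) := by
    intro i j
    have hK0 : 0 ≤ K := (abs_nonneg _).trans (hK i)
    have h1 : |a i - a j| ≤ 2 * K := by
      have := abs_sub (a i) (a j)
      linarith [hK i, hK j]
    have h2 : |y (π j) - y (π i)| ≤ |y (π j)| + |y (π i)| := abs_sub _ _
    have h3 : |swapDiff a y π i j| ≤ 2 * K * (|y (π j)| + |y (π i)|) := by
      unfold swapDiff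
      rw [abs_mul]
      gcongr
    calc |swapDiff a y π i j| ^ 3 ≤ (2 * K * (|y (π j)| + |y (π i)|)) ^ 3 := by gcongr
      _ = 8 * K ^ 3 * (|y (π j)| + |y (π i)|) ^ 3 := by ring
      _ ≤ 8 * K ^ 3 * (2 ^ (3 - 1) * (|y (π j)| ^ 3 + |y (π i)| ^ 3)) := by
          gcongr
          exact add_pow_le (abs_nonneg _) (abs_nonneg _) 3
      _ = _ := by ring
  have hs : ∑ i, |y (π i)| ^ 3 = ∑ i, |y i| ^ 3 := sum_comp_perm (fun i => |y i| ^ 3) π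
  calc _ ≤ ∑ i : Fin n, ∑ j : Fin n,
        (32 * K ^ 3 * (|y (π j)| ^ 3 * 1) + 32 * K ^ 3 * (|y (π i)| ^ 3 * 1)) :=
        sum_le_sum fun i _ => sum_le_sum fun j _ => h i j
    _ = _ := by
      simp only [sum_add_distrib, ← mul_sum, ← sum_mul, hs, sum_const, card_univ,
        Fintype.card_fin, nsmul_eq_mul]
      ring

lemma norm_stein_remainder_le (hK : ∀ i, |a i| ≤ K) (s : ℝ) (π : Equiv.Perm (Fin n)) :
    ‖∑ i, ∑ j, (swapDiff a y π i j : ℂ)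
          * (Complex.exp ((s * (permSum a y π + swapDiff a y π i j) : ℝ) * Complex.I)
              - Complex.exp ((s * permSum a y π : ℝ) * Complex.I))
        - s * Complex.I * (∑ i, ∑ j, swapDiff a y π i j ^ 2 : ℝ)
          * Complex.exp ((s * permSum a y π : ℝ) * Complex.I)‖
      ≤ 128 * s ^ 2 * n * K ^ 3 * ∑ i, |y i| ^ 3 := by
  set W := permSum a y π
  have hterm : ∀ i j, ‖(swapDiff a y π i j : ℂ)
        * (Complex.exp ((s * (W + swapDiff a y π i j) : ℝ) * Complex.I)
              - Complex.exp ((s * W : ℝ) * Complex.I))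
        - s * Complex.I * (swapDiff a y π i j ^ 2 : ℝ) * Complex.exp ((s * W : ℝ) * Complex.I)‖
      ≤ 2 * s ^ 2 * |swapDiff a y π i j| ^ 3 := by
    intro i j
    set D := swapDiff a y π i j
    have h1 : (D : ℂ) * (Complex.exp ((s * (W + D) : ℝ) * Complex.I)
              - Complex.exp ((s * W : ℝ) * Complex.I))
        - s * Complex.I * (D ^ 2 : ℝ) * Complex.exp ((s * W : ℝ) * Complex.I)
        = D * (Complex.exp ((s * W : ℝ) * Complex.I)
          * (Complex.exp ((s * D : ℝ) * Complex.I) - 1 - (s * D : ℝ) * Complex.I)) := by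
      have : (((s * (W + D) : ℝ) : ℂ) * Complex.I)
          = (s * W : ℝ) * Complex.I + (s * D : ℝ) * Complex.I := by
        push_cast; ring
      rw [this, Complex.exp_add]
      push_cast
      ring
    rw [h1, norm_mul, norm_mul, Complex.norm_exp_ofReal_mul_I, one_mul, Complex.norm_real,
      Real.norm_eq_abs]
    calc |D| * _ ≤ |D| * (2 * (s * D) ^ 2) := by
          gcongr
          exact norm_exp_mul_I_sub_le _
      _ = 2 * s ^ 2 * |D| ^ 3 := by rw [mul_pow, ← sq_abs D]; ring
  have hsum : ∑ i, ∑ j, (swapDiff a y π i j : ℂ)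
          * (Complex.exp ((s * (W + swapDiff a y π i j) : ℝ) * Complex.I)
              - Complex.exp ((s * W : ℝ) * Complex.I))
        - s * Complex.I * (∑ i, ∑ j, swapDiff a y π i j ^ 2 : ℝ)
          * Complex.exp ((s * W : ℝ) * Complex.I)
      = ∑ i, ∑ j, ((swapDiff a y π i j : ℂ)
        * (Complex.exp ((s * (W + swapDiff a y π i j) : ℝ) * Complex.I)
              - Complex.exp ((s * W : ℝ) * Complex.I))
        - s * Complex.I * (swapDiff a y π i j ^ 2 : ℝ)
          * Complex.exp ((s * W : ℝ) * Complex.I)) := by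
    simp only [sum_sub_distrib, ← mul_sum, ← sum_mul, Complex.ofReal_sum]
  rw [hsum]
  calc _ ≤ ∑ i, ∑ j, 2 * s ^ 2 * |swapDiff a y π i j| ^ 3 :=
        (norm_sum_le _ _).trans <| sum_le_sum fun i _ =>
          (norm_sum_le _ _).trans <| sum_le_sum fun j _ => hterm i j
    _ = 2 * s ^ 2 * ∑ i, ∑ j, |swapDiff a y π i j| ^ 3 := by simp only [← mul_sum]
    _ ≤ 2 * s ^ 2 * (64 * n * K ^ 3 * ∑ i, |y i| ^ 3) := by
        gcongr
        exact sum_abs_swapDiff_cube_le hK π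
    _ = _ := by ring

lemma sum_sq_le_of_abs_le (hK : ∀ i, |a i| ≤ K) : ∑ i, a i ^ 2 ≤ n * K ^ 2 := by
  calc ∑ i, a i ^ 2 ≤ ∑ _i : Fin n, K ^ 2 :=
        sum_le_sum fun i _ => sq_le_sq' (abs_le.mp (hK i)).1 (abs_le.mp (hK i)).2
    _ = _ := by simp

lemma mul_div_sub_one_le (hn : 2 ≤ n) {c : ℝ} (hc : 0 ≤ c) : n * c / ((n : ℝ) - 1) ≤ 2 * c := by
  have hn' : (2 : ℝ) ≤ n := by exact_mod_cast hn
  rw [div_le_iff₀ (by linarith)]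
  nlinarith

/-- The conditional variance of the exchangeable pair concentrates. -/
lemma pexp_abs_permSum_sq_sub_le (hn : 2 ≤ n) (hy2 : ∑ i, y i ^ 2 = 1) (hK : ∀ i, |a i| ≤ K) :
    pexp n (fun π => |permSum (fun i => a i ^ 2) (fun i => y i ^ 2) π - (∑ i, a i ^ 2) / n|)
      ≤ √(2 * K ^ 4 * ∑ i, |y i| ^ 3) := by
  have hn' : (2 : ℝ) ≤ n := by exact_mod_cast hn
  have hc : ∀ π, permSum (fun i => a i ^ 2) (fun i => y i ^ 2) π - (∑ i, a i ^ 2) / n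
      = permSum (fun i => a i ^ 2) (fun i => y i ^ 2 - 1 / n) π := by
    intro π
    simp only [permSum, mul_sub, sum_sub_distrib, ← sum_mul]
    ring
  simp only [hc]
  refine (pexp_abs_le_sqrt _).trans (Real.sqrt_le_sqrt ?_)
  have hy0 : ∑ i, (y i ^ 2 - 1 / n) = 0 := by
    simp only [sum_sub_distrib, hy2, sum_const, card_univ, Fintype.card_fin, nsmul_eq_mul]
    field_simp
    ring
  refine (pexp_permSum_sq_le hn hy0).trans ?_
  have hA : ∑ i, (a i ^ 2) ^ 2 ≤ n * (K ^ 2) ^ 2 :=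
    sum_sq_le_of_abs_le fun i => by
      rw [abs_pow]
      exact pow_le_pow_left₀ (abs_nonneg _) (hK i) 2
  have hY : ∑ i, (y i ^ 2 - 1 / n) ^ 2 ≤ ∑ i, |y i| ^ 3 := by
    have h1 : ∑ i, (y i ^ 2 - 1 / n) ^ 2 = ∑ i, y i ^ 4 - 1 / n := by
      have : ∀ i, (y i ^ 2 - 1 / n) ^ 2 = y i ^ 4 - 2 / n * y i ^ 2 + 1 / n ^ 2 := by
        intro i; ring
      simp only [this, sum_add_distrib, sum_sub_distrib, ← mul_sum, hy2, sum_const, card_univ,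
        Fintype.card_fin, nsmul_eq_mul]
      field_simp
      ring
    have h2 : ∑ i, y i ^ 4 ≤ ∑ i, |y i| ^ 3 := by
      refine sum_le_sum fun i _ => ?_
      have hi : |y i| ^ 2 ≤ 1 := by
        rw [sq_abs, ← hy2]
        exact single_le_sum (f := fun i => y i ^ 2) (fun j _ => sq_nonneg _) (mem_univ i)
      have hi' : |y i| ≤ 1 := by
        have := abs_nonneg (y i)
        nlinarith
      calc y i ^ 4 = |y i| ^ 4 := by rw [Even.pow_abs (by decide)]
        _ ≤ |y i| ^ 3 := pow_le_pow_of_le_one (abs_nonneg _) hi' (by norm_num)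
    have : (0 : ℝ) ≤ 1 / n := by positivity
    linarith
  have hβ : 0 ≤ ∑ i, |y i| ^ 3 := sum_nonneg fun i _ => by positivity
  have hn1 : (0 : ℝ) ≤ n - 1 := by linarith
  calc _ ≤ n * (K ^ 2) ^ 2 * (∑ i, |y i| ^ 3) / ((n : ℝ) - 1) := by gcongr
    _ = n * (K ^ 4 * ∑ i, |y i| ^ 3) / ((n : ℝ) - 1) := by ring
    _ ≤ 2 * (K ^ 4 * ∑ i, |y i| ^ 3) := mul_div_sub_one_le hn (by positivity)
    _ = _ := by ring

/-- The error bound in the differential equation for `permChar`. -/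
noncomputable def steinBound (n : ℕ) (K β s : ℝ) : ℝ :=
  32 * s ^ 2 * K ^ 3 * β + |s| * (√(2 * K ^ 4 * β) / 2 + 2 * K ^ 2 / n)

lemma norm_permCharDeriv_add_le (hn : 2 ≤ n) (ha : ∑ i, a i = 0) (hy : ∑ i, y i = 0)
    (hy2 : ∑ i, y i ^ 2 = 1) (hK : ∀ i, |a i| ≤ K) (s : ℝ) :
    ‖permCharDeriv a y s + (s * ((∑ i, a i ^ 2) / n) : ℝ) * permChar a y s‖
      ≤ steinBound n K (∑ i, |y i| ^ 3) s := by
  have hn' : (2 : ℝ) ≤ n := by exact_mod_cast hn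
  have hN : (0 : ℝ) < n.factorial := by positivity
  set β := ∑ i, |y i| ^ 3
  set v := (∑ i, a i ^ 2) / n with hv
  set V := fun π => permSum (fun i => a i ^ 2) (fun i => y i ^ 2) π
  set f : ℝ → ℂ := fun w => Complex.exp ((s * w : ℝ) * Complex.I) with hf
  have hstein := stein_identity (a := a) hy f
  set E : Equiv.Perm (Fin n) → ℂ := fun π => ∑ i, ∑ j, (swapDiff a y π i j : ℂ)
          * (f (permSum a y π + swapDiff a y π i j) - f (permSum a y π))
        - s * Complex.I * (∑ i, ∑ j, swapDiff a y π i j ^ 2 : ℝ) * f (permSum a y π) with hE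
  have hEb : ∀ π, ‖E π‖ ≤ 128 * s ^ 2 * n * K ^ 3 * β := norm_stein_remainder_le hK s
  have hsq : ∀ π, ∑ i, ∑ j, swapDiff a y π i j ^ 2
      = 2 * n * V π + 2 * n * v + 4 * permSum a y π ^ 2 := by
    intro π
    rw [sum_swapDiff_sq ha hy, hy2, hv]
    simp only [V]
    field_simp
  have key : 4 * n * (permCharDeriv a y s + (s * v : ℝ) * permChar a y s)
      = (∑ π, (Complex.I * E π
        + (s * (2 * n * (v - V π) - 4 * permSum a y π ^ 2) : ℝ) * f (permSum a y π)))
        / n.factorial := by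
    have hNc : (n.factorial : ℂ) ≠ 0 := by exact_mod_cast hN.ne'
    have h1 : 4 * n * (permCharDeriv a y s + (s * v : ℝ) * permChar a y s)
        = (Complex.I * (4 * n * ∑ π, (permSum a y π : ℂ) * f (permSum a y π))
          + ∑ π, (4 * n * s * v : ℝ) * f (permSum a y π)) / n.factorial := by
      have h2 : permCharDeriv a y s
          = Complex.I * (∑ π, (permSum a y π : ℂ) * f (permSum a y π)) / n.factorial := by
        rw [mul_sum]
        rfl
      have h3 : permChar a y s = (∑ π, f (permSum a y π)) / n.factorial := rfl
      rw [h2, h3, ← mul_sum]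
      push_cast
      field_simp
    rw [h1, hstein, mul_sum, ← sum_add_distrib]
    congr 1
    refine sum_congr rfl fun π _ => ?_
    simp only [hE, hsq]
    push_cast
    linear_combination (s * (2 * n * V π + 2 * n * v + 4 * permSum a y π ^ 2)
      * f (permSum a y π) : ℂ) * Complex.I_mul_I
  have hnorm : 4 * n * ‖permCharDeriv a y s + (s * v : ℝ) * permChar a y s‖
      ≤ pexp n (fun π => 128 * s ^ 2 * n * K ^ 3 * β
        + (|s| * (2 * n) * |V π - v| + |s| * 4 * permSum a y π ^ 2)) := by
    have : 4 * n * ‖permCharDeriv a y s + (s * v : ℝ) * permChar a y s‖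
        = ‖4 * n * (permCharDeriv a y s + (s * v : ℝ) * permChar a y s)‖ := by
      simp
    rw [this, key, norm_div, Complex.norm_natCast]
    unfold pexp
    gcongr
    refine (norm_sum_le _ _).trans (sum_le_sum fun π _ => ?_)
    refine (norm_add_le _ _).trans ?_
    rw [norm_mul, norm_mul, Complex.norm_I, one_mul, Complex.norm_real,
      Complex.norm_exp_ofReal_mul_I, mul_one, Real.norm_eq_abs, abs_mul]
    refine add_le_add (hEb π) ?_
    calc |s| * |2 * n * (v - V π) - 4 * permSum a y π ^ 2|
        ≤ |s| * (|2 * n * (v - V π)| + |4 * permSum a y π ^ 2|) := by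
          gcongr
          exact abs_sub _ _
      _ = _ := by
          rw [abs_mul (2 * (n : ℝ)), abs_sub_comm, abs_of_nonneg (by positivity : (0 : ℝ) ≤ 2 * n),
            abs_of_nonneg (by positivity : 0 ≤ 4 * permSum a y π ^ 2)]
          ring
  simp only [pexp_add, pexp_const_mul, pexp_const] at hnorm
  have hA := sum_sq_le_of_abs_le hK
  have hW : pexp n (fun π => permSum a y π ^ 2) ≤ 2 * K ^ 2 := by
    refine (pexp_permSum_sq_le hn hy).trans ?_
    rw [hy2, mul_one]
    have hn1 : (0 : ℝ) ≤ n - 1 := by linarith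
    exact (by gcongr : _ ≤ n * K ^ 2 / ((n : ℝ) - 1)).trans (mul_div_sub_one_le hn (sq_nonneg K))
  have hV := pexp_abs_permSum_sq_sub_le hn hy2 hK
  have hfin : 4 * n * ‖permCharDeriv a y s + (s * v : ℝ) * permChar a y s‖
      ≤ 4 * n * steinBound n K β s := by
    refine hnorm.trans ?_
    calc _ ≤ 128 * s ^ 2 * n * K ^ 3 * β
          + (|s| * (2 * n) * √(2 * K ^ 4 * β) + |s| * 4 * (2 * K ^ 2)) := by gcongr
      _ = _ := by
        unfold steinBound
        field_simp
        ring
  exact le_of_mul_le_mul_left hfin (by positivity)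

/-- A quantitative combinatorial central limit theorem for characteristic functions. -/
lemma norm_permChar_sub_le (hn : 2 ≤ n) (ha : ∑ i, a i = 0) (hy : ∑ i, y i = 0)
    (hy2 : ∑ i, y i ^ 2 = 1) (hK : ∀ i, |a i| ≤ K) (s : ℝ) :
    ‖permChar a y s - Real.exp (-(s ^ 2 * ((∑ i, a i ^ 2) / n) / 2))‖
      ≤ |s| * steinBound n K (∑ i, |y i| ^ 3) s := by
  have hn' : (2 : ℝ) ≤ n := by exact_mod_cast hn
  have hK0 : 0 ≤ K := (abs_nonneg _).trans (hK ⟨0, by omega⟩)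
  set β := ∑ i, |y i| ^ 3 with hβ
  have hβ0 : 0 ≤ β := sum_nonneg fun i _ => by positivity
  set v := (∑ i, a i ^ 2) / n with hv
  have hv0 : 0 ≤ v := by
    rw [hv]
    exact div_nonneg (sum_nonneg fun i _ => sq_nonneg _) (by linarith)
  set g : ℝ → ℂ := fun τ => (Real.exp (τ ^ 2 * v / 2) : ℂ) * permChar a y τ with hg
  have hder : ∀ τ, HasDerivAt g ((Real.exp (τ ^ 2 * v / 2) : ℂ)
      * (permCharDeriv a y τ + (τ * v : ℝ) * permChar a y τ)) τ := by
    intro τ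
    have h1 : HasDerivAt (fun τ : ℝ => Real.exp (τ ^ 2 * v / 2))
        (Real.exp (τ ^ 2 * v / 2) * (τ * v)) τ := by
      have h0 : HasDerivAt (fun τ : ℝ => τ ^ 2 * v / 2) (τ * v) τ := by
        refine ((((hasDerivAt_id τ).pow 2).mul_const v).div_const 2).congr_deriv ?_
        simp only [id]
        ring
      exact h0.exp
    refine ((h1.ofReal_comp).mul (hasDerivAt_permChar a y τ)).congr_deriv ?_
    push_cast
    ring
  have hbound : ∀ τ ∈ Set.Icc (-|s|) |s|, ‖(Real.exp (τ ^ 2 * v / 2) : ℂ)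
      * (permCharDeriv a y τ + (τ * v : ℝ) * permChar a y τ)‖
      ≤ Real.exp (s ^ 2 * v / 2) * steinBound n K β s := by
    intro τ hτ
    have hτs : |τ| ≤ |s| := abs_le.mpr hτ
    have hτs2 : τ ^ 2 ≤ s ^ 2 := sq_le_sq.mpr hτs
    rw [norm_mul, Complex.norm_real, Real.norm_eq_abs, Real.abs_exp]
    gcongr
    refine (norm_permCharDeriv_add_le hn ha hy hy2 hK τ).trans ?_
    unfold steinBound
    gcongr
  have hmv := (convex_Icc (-|s|) |s|).norm_image_sub_le_of_norm_hasDerivWithin_le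
    (fun τ _ => (hder τ).hasDerivWithinAt) hbound
    (x := 0) (y := s) (by simp) (abs_le.mp le_rfl)
  have h0 : g 0 = 1 := by
    have hN : (n.factorial : ℂ) ≠ 0 := by exact_mod_cast n.factorial_ne_zero
    simp [hg, permChar, Fintype.card_perm, hN]
  rw [h0, sub_zero, Real.norm_eq_abs] at hmv
  have hfac : permChar a y s - Real.exp (-(s ^ 2 * v / 2))
      = (Real.exp (-(s ^ 2 * v / 2)) : ℂ) * (g s - 1) := by
    rw [mul_sub, hg, ← mul_assoc, ← Complex.ofReal_mul, ← Real.exp_add]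
    simp
  rw [hfac, norm_mul, Complex.norm_real, Real.norm_eq_abs, Real.abs_exp]
  calc _ ≤ Real.exp (-(s ^ 2 * v / 2)) * (Real.exp (s ^ 2 * v / 2) * steinBound n K β s * |s|) := by
        gcongr
    _ = (Real.exp (-(s ^ 2 * v / 2)) * Real.exp (s ^ 2 * v / 2)) * (|s| * steinBound n K β s) := by
        ring
    _ = _ := by rw [← Real.exp_add]; simp

end LinearStatistic

lemma charFun_permDist (n : ℕ) (f : Equiv.Perm (Fin n) → ℝ) (s : ℝ) :
    charFun (permDist n f : Measure ℝ) s
      = (∑ π, Complex.exp ((s * f π : ℝ) * Complex.I)) / n.factorial := by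
  have : MeasurableSingletonClass (Equiv.Perm (Fin n)) := ⟨fun _ => trivial⟩
  have hf : AEMeasurable f (permP n : Measure (Equiv.Perm (Fin n))) :=
    Measurable.aemeasurable fun _ _ => trivial
  rw [charFun_apply_real]
  unfold permDist
  rw [ProbabilityMeasure.toMeasure_map, integral_map hf (by fun_prop)]
  simp only [permP, ProbabilityMeasure.coe_mk]
  rw [PMF.integral_eq_sum]
  simp only [PMF.uniformOfFintype_apply, Fintype.card_perm, Fintype.card_fin, ENNReal.toReal_inv,
    ENNReal.toReal_natCast, ← smul_sum]
  push_cast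
  rw [Complex.real_smul, div_eq_inv_mul]
  push_cast
  rfl

/-- The combinatorial central limit theorem with bounded weights, under a Lyapunov condition. -/
lemma tendsto_permDist_permSum (a x : (n : ℕ) → Fin n → ℝ) (K v : ℝ)
    (h : ∀ᶠ n in atTop, ∑ i, a n i = 0 ∧ ∑ i, x n i = 0 ∧ ∑ i, x n i ^ 2 = 1
      ∧ ∀ i, |a n i| ≤ K)
    (hβ : Tendsto (fun n => ∑ i, |x n i| ^ 3) atTop (𝓝 0))
    (hv : Tendsto (fun n => (∑ i, a n i ^ 2) / n) atTop (𝓝 v)) :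
    Tendsto (fun n => permDist n (permSum (a n) (x n))) atTop (𝓝 (gaussLimit v)) := by
  refine ProbabilityMeasure.tendsto_iff_tendsto_charFun.2 fun s => ?_
  have hv0 : 0 ≤ v := ge_of_tendsto' hv fun n => by positivity
  have hlim : charFun (gaussLimit v : Measure ℝ) s = Real.exp (-(s ^ 2 * v / 2)) := by
    simp only [gaussLimit, ProbabilityMeasure.coe_mk, charFun_gaussianReal,
      Real.coe_toNNReal _ hv0]
    push_cast
    congr 1
    ring
  rw [hlim]
  have hg : Tendsto (fun n : ℕ => ((Real.exp (-(s ^ 2 * ((∑ i, a n i ^ 2) / n) / 2)) : ℝ) : ℂ))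
      atTop (𝓝 (Real.exp (-(s ^ 2 * v / 2)) : ℝ)) := by
    refine (Complex.continuous_ofReal.tendsto _).comp ?_
    exact (Real.continuous_exp.tendsto _).comp (((hv.const_mul _).div_const _).neg)
  have hb : Tendsto (fun n : ℕ => |s| * steinBound n K (∑ i, |x n i| ^ 3) s) atTop (𝓝 0) := by
    have h1 := hβ.const_mul (32 * s ^ 2 * K ^ 3)
    have h2 := ((Real.continuous_sqrt.tendsto _).comp (hβ.const_mul (2 * K ^ 4))).div_const 2
    have h3 : Tendsto (fun n : ℕ => 2 * K ^ 2 / (n : ℝ)) atTop (𝓝 0) :=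
      tendsto_const_div_atTop_nhds_zero_nat _
    have h4 := (h1.add ((h2.add h3).const_mul |s|)).const_mul |s|
    simpa [steinBound, Function.comp_def] using h4
  have hd : Tendsto (fun n => permChar (a n) (x n) s
      - (Real.exp (-(s ^ 2 * ((∑ i, a n i ^ 2) / n) / 2)) : ℝ)) atTop (𝓝 0) := by
    refine squeeze_zero_norm' ?_ hb
    filter_upwards [h, eventually_ge_atTop 2] with n hn hn2
    exact norm_permChar_sub_le hn2 hn.1 hn.2.1 hn.2.2.1 hn.2.2.2 s
  have := hd.add hg
  simp only [sub_add_cancel, zero_add] at this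
  simp only [charFun_permDist]
  exact this

/-- The covariance kernel of the Brownian bridge on `[0, T]` is strictly positive definite. -/
lemma bridge_kernel_pos (m : ℕ) : ∀ (u : Fin m → ℝ) (T : ℝ), StrictMono u → (∀ i, 0 < u i) →
    (∀ i, u i < T) → ∀ y : Fin m → ℝ, y ≠ 0 →
    0 < ∑ i, ∑ j, y i * y j * (min (u i) (u j) - u i * u j / T) := by
  induction m with
  | zero => exact fun u T _ _ _ y hy => absurd (Subsingleton.elim y 0) hy
  | succ m ih =>
    intro u T hu h0 hT y hy
    set w := u (Fin.last m) with hw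
    have hw0 : 0 < w := h0 _
    have hwT : 1 / T < 1 / w := one_div_lt_one_div_of_lt hw0 (hT _)
    have hlt : ∀ i : Fin m, u i.castSucc < w := fun i => hu (Fin.castSucc_lt_last i)
    have hsplit : ∑ i, ∑ j, y i * y j * (min (u i) (u j) - u i * u j / T)
        = ∑ i : Fin m, ∑ j : Fin m, y i.castSucc * y j.castSucc
            * (min (u i.castSucc) (u j.castSucc) - u i.castSucc * u j.castSucc / w)
          + (1 / w - 1 / T) * (∑ i, y i * u i) ^ 2 := by
      have h1 : ∀ i j, y i * y j * (min (u i) (u j) - u i * u j / T)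
          = y i * y j * (min (u i) (u j) - u i * u j / w)
            + (1 / w - 1 / T) * ((y i * u i) * (y j * u j)) := by
        intro i j; ring
      simp only [h1, sum_add_distrib, ← mul_sum, ← sum_mul, ← sq]
      congr 1
      have hz1 : ∀ i : Fin m, min (u i.castSucc) w - u i.castSucc * w / w = 0 := fun i => by
        rw [min_eq_left (hlt i).le]; field_simp; ring
      have hz2 : ∀ i : Fin m, min w (u i.castSucc) - w * u i.castSucc / w = 0 := fun i => by
        rw [min_eq_right (hlt i).le]; field_simp; ring
      have hz3 : min w w - w * w / w = 0 := by rw [min_self]; field_simp; ring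
      simp only [Fin.sum_univ_castSucc, ← hw, hz1, hz2, hz3, mul_zero, add_zero, sum_const_zero]
    rw [hsplit]
    by_cases hinit : (fun i : Fin m => y i.castSucc) = 0
    · have hi : ∀ i : Fin m, y i.castSucc = 0 := fun i => congrFun hinit i
      have hl : y (Fin.last m) ≠ 0 := by
        intro hl
        apply hy
        funext i
        refine Fin.lastCases hl (fun i => hi i) i
      simp only [hi, Fin.sum_univ_castSucc, zero_mul, sum_const_zero, zero_add]
      have := sub_pos.2 hwT
      have : y (Fin.last m) * u (Fin.last m) ≠ 0 := mul_ne_zero hl hw0.ne'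
      positivity
    · refine add_pos_of_pos_of_nonneg ?_ (mul_nonneg (sub_pos.2 hwT).le (sq_nonneg _))
      exact ih (fun i => u i.castSucc) w (hu.comp (Fin.strictMono_castSucc)) (fun i => h0 _) hlt
        (fun i => y i.castSucc) hinit

lemma rhoDiff_eq {u v : ℝ} (hu0 : 0 < u) (hu1 : u < 1) (hv0 : 0 < v) (hv1 : v < 1) :
    rhoDiff u v = (√(u * (1 - u)))⁻¹ * (√(v * (1 - v)))⁻¹ * (min u v - u * v / 1) := by
  have hu : 0 ≤ u * (1 - u) := mul_nonneg hu0.le (by linarith)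
  have hv : 0 ≤ v * (1 - v) := mul_nonneg hv0.le (by linarith)
  unfold rhoDiff
  rcases le_total u v with h | h
  · rw [min_eq_left h, max_eq_right h, Real.sqrt_mul hu, div_eq_mul_inv, mul_inv]
    ring
  · rw [min_eq_right h, max_eq_left h, Real.sqrt_mul hv, div_eq_mul_inv, mul_inv]
    ring

lemma rhoDiff_self {u : ℝ} (hu0 : 0 < u) (hu1 : u < 1) : rhoDiff u u = 1 := by
  have hu : 0 < u * (1 - u) := mul_pos hu0 (by linarith)
  unfold rhoDiff
  rw [min_self, max_self, Real.sqrt_mul_self hu.le, div_self hu.ne']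

lemma posDef_rhoDiff {m : ℕ} (u : Fin m → ℝ) (hmono : StrictMono u) (hu0 : ∀ i, 0 < u i)
    (hu1 : ∀ i, u i < 1) : (Matrix.of fun i j : Fin m => rhoDiff (u i) (u j)).PosDef := by
  have hs : ∀ i, 0 < √(u i * (1 - u i)) := fun i =>
    Real.sqrt_pos.2 (mul_pos (hu0 i) (by linarith [hu1 i]))
  refine Matrix.PosDef.of_dotProduct_mulVec_pos ?_ ?_
  · ext i j
    simp [rhoDiff, min_comm, max_comm]
  · intro x hx
    have h := bridge_kernel_pos m u 1 hmono hu0 hu1 (fun i => x i * (√(u i * (1 - u i)))⁻¹) (by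
      contrapose! hx
      funext i
      have := congrFun hx i
      simpa [(hs i).ne'] using this)
    refine h.trans_eq ?_
    simp only [dotProduct, Matrix.mulVec, Matrix.of_apply, mul_sum]
    refine sum_congr rfl fun i _ => sum_congr rfl fun j _ => ?_
    rw [rhoDiff_eq (hu0 i) (hu1 i) (hu0 j) (hu1 j)]
    simp
    ring

/-- The centered indicator of the first `t` indices. -/
noncomputable def centeredInd (n t : ℕ) (i : Fin n) : ℝ :=
  (if (i : ℕ) < t then 1 else 0) - (t : ℝ) / n

/-- The limiting-order variance `t (n - t) / (n (n - 1))` of a centered partial sum. -/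
noncomputable def blockVar (n t : ℕ) : ℝ :=
  (t / n : ℝ) * (1 - t / n) * (1 - 1 / n : ℝ)⁻¹

lemma sum_ind {n t : ℕ} (ht : t ≤ n) : ∑ i : Fin n, (if (i : ℕ) < t then (1 : ℝ) else 0) = t := by
  rw [Fin.sum_univ_eq_sum_range (fun i => if i < t then (1 : ℝ) else 0), sum_boole]
  congr 1
  have : (range n).filter (· < t) = range t := by
    ext i
    simp only [mem_filter, mem_range]
    omega
  rw [this, card_range]

lemma sum_centeredInd {n t : ℕ} (hn : 0 < n) (ht : t ≤ n) : ∑ i, centeredInd n t i = 0 := by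
  have : (n : ℝ) ≠ 0 := by positivity
  simp only [centeredInd, sum_sub_distrib, sum_ind ht, sum_const, card_univ, Fintype.card_fin,
    nsmul_eq_mul]
  field_simp
  ring

lemma sum_centeredInd_mul {n t s : ℕ} (hn : 0 < n) (ht : t ≤ n) (hs : s ≤ n) :
    ∑ i, centeredInd n t i * centeredInd n s i
      = n * (min (t / n : ℝ) (s / n) - t / n * (s / n)) := by
  have hn0 : (n : ℝ) ≠ 0 := by positivity
  have h : ∀ i : Fin n, centeredInd n t i * centeredInd n s i
      = (if (i : ℕ) < min t s then (1 : ℝ) else 0)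
        - (t / n : ℝ) * (if (i : ℕ) < s then (1 : ℝ) else 0)
        - (s / n : ℝ) * (if (i : ℕ) < t then (1 : ℝ) else 0) + (t / n : ℝ) * (s / n) := by
    intro i
    have h2 : (if (i : ℕ) < min t s then (1 : ℝ) else 0)
        = (if (i : ℕ) < t then (1 : ℝ) else 0) * (if (i : ℕ) < s then (1 : ℝ) else 0) := by
      simp only [lt_min_iff, ite_and, ite_mul, one_mul, zero_mul]
    rw [h2]
    unfold centeredInd
    ring
  simp only [h, sum_add_distrib, sum_sub_distrib, ← mul_sum, sum_ind ht, sum_ind hs,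
    sum_ind ((min_le_left t s).trans ht), sum_const, card_univ, Fintype.card_fin, nsmul_eq_mul]
  rw [min_div_div_right (by positivity)]
  push_cast
  field_simp
  ring

lemma abs_centeredInd_le {n t : ℕ} (ht : t ≤ n) (i : Fin n) : |centeredInd n t i| ≤ 1 := by
  have h0 : (0 : ℝ) ≤ t / n := by positivity
  have h1 : (t : ℝ) / n ≤ 1 := div_le_one_of_le₀ (by exact_mod_cast ht) (by positivity)
  unfold centeredInd
  rw [abs_le]
  split_ifs <;> constructor <;> linarith

lemma sum_centeredInd_sq {n t : ℕ} (hn : 2 ≤ n) (ht : t ≤ n) :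
    ∑ i, centeredInd n t i ^ 2 = (n - 1) * blockVar n t := by
  have hn' : (2 : ℝ) ≤ n := by exact_mod_cast hn
  have hn0 : (n : ℝ) ≠ 0 := by linarith
  have hn1 : (n : ℝ) - 1 ≠ 0 := by linarith
  have : (1 - 1 / n : ℝ) ≠ 0 := by
    rw [one_sub_div hn0]
    exact div_ne_zero hn1 hn0
  simp only [sq, sum_centeredInd_mul (by omega : 0 < n) ht ht, min_self, blockVar]
  field_simp

/-- The centered row means of `R`. -/
noncomputable def rowDev (n : ℕ) (R : Fin n → Fin n → ℝ) (i : Fin n) : ℝ :=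
  Rbar n R i - r0 n R

lemma sum_rowDev {n : ℕ} (hn : 0 < n) (R : Fin n → Fin n → ℝ) : ∑ i, rowDev n R i = 0 := by
  have : (n : ℝ) ≠ 0 := by positivity
  simp only [rowDev, sum_sub_distrib, sum_const, card_univ, Fintype.card_fin, nsmul_eq_mul, r0]
  field_simp
  ring

lemma sum_rowDev_sq {n : ℕ} (hn : 0 < n) (R : Fin n → Fin n → ℝ) :
    ∑ i, rowDev n R i ^ 2 = n * (r1sq n R - r0 n R ^ 2) := by
  have hn0 : (n : ℝ) ≠ 0 := by positivity
  have h : ∑ i, Rbar n R i = n * r0 n R := by unfold r0; field_simp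
  simp only [rowDev, sub_sq, sum_add_distrib, sum_sub_distrib, ← mul_sum, ← sum_mul, h, sum_const,
    card_univ, Fintype.card_fin, nsmul_eq_mul, r1sq]
  field_simp
  ring

/-- `U_diff` is an affine function of a linear permutation statistic. -/
lemma exists_Udiff_eq {n t : ℕ} (hn : 2 ≤ n) (R : Fin n → Fin n → ℝ)
    (hsym : ∀ i j, R i j = R j i) :
    ∃ c, ∀ π, Udiff n R π 0 t
      = 2 * (n - 1) * permSum (centeredInd n t) (rowDev n R) π + c := by
  have hn' : (2 : ℝ) ≤ n := by exact_mod_cast hn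
  have hn1 : (n : ℝ) - 1 ≠ 0 := by linarith
  set g : Fin n → ℝ := fun i => if (i : ℕ) < t then 1 else 0 with hg
  refine ⟨2 * (n - 1) * r0 n R * (∑ i, g i) - ∑ i, ∑ j, R i j, fun π => ?_⟩
  have hterm : ∀ i j : Fin n,
      (if 0 ≤ (i : ℕ) ∧ (i : ℕ) < t ∧ 0 ≤ (j : ℕ) ∧ (j : ℕ) < t then R (π i) (π j) else 0)
      - (if ((i : ℕ) < 0 ∨ t ≤ (i : ℕ)) ∧ ((j : ℕ) < 0 ∨ t ≤ (j : ℕ)) then R (π i) (π j) else 0)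
      = g i * R (π i) (π j) + g j * R (π j) (π i) - R (π i) (π j) := by
    intro i j
    rw [hsym (π j) (π i)]
    simp only [hg, Nat.zero_le, true_and, Nat.not_lt_zero, false_or]
    by_cases hi : (i : ℕ) < t <;> by_cases hj : (j : ℕ) < t <;>
      simp [hi, hj, not_le.2, not_lt.1]
  have hrow : ∀ i, ∑ j, R (π i) (π j) = (n - 1) * (rowDev n R (π i) + r0 n R) := by
    intro i
    rw [sum_comp_perm (fun k => R (π i) k) π]
    unfold rowDev Rbar
    field_simp
    ring
  have htot : ∑ i, ∑ j, R (π i) (π j) = ∑ i, ∑ j, R i j := by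
    rw [sum_comp_perm (fun k => ∑ j, R k (π j)) π]
    exact sum_congr rfl fun k _ => sum_comp_perm (fun l => R k l) π
  have hc : permSum (centeredInd n t) (rowDev n R) π = permSum g (rowDev n R) π :=
    permSum_sub_const (sum_rowDev (by omega) R) _ π
  have hA : ∑ i, ∑ j, g i * R (π i) (π j)
      = (n - 1) * (permSum g (rowDev n R) π + r0 n R * ∑ i, g i) := by
    simp only [← mul_sum, hrow, permSum]
    rw [mul_add, mul_sum, mul_sum, mul_sum, ← sum_add_distrib]
    refine sum_congr rfl fun i _ => by ring
  unfold Udiff U1 U2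
  rw [← sum_sub_distrib]
  simp only [← sum_sub_distrib, hterm]
  simp only [sum_add_distrib, sum_sub_distrib]
  rw [sum_comm (f := fun i j => g j * R (π j) (π i)), hA, htot, hc]
  ring

lemma pexp_affine_permSum {n : ℕ} {a y : Fin n → ℝ} (k c : ℝ) (hy : ∑ i, y i = 0) :
    pexp n (fun π => k * permSum a y π + c) = c := by
  rw [pexp_add, pexp_const_mul, pexp_const, pexp_permSum, hy]
  simp

lemma pvar_affine_permSum {n : ℕ} {a y : Fin n → ℝ} (k c : ℝ) (hn : 2 ≤ n) (ha : ∑ i, a i = 0)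
    (hy : ∑ i, y i = 0) :
    pvar n (fun π => k * permSum a y π + c)
      = k ^ 2 * ((∑ i, a i ^ 2) * (∑ i, y i ^ 2) / (n - 1)) := by
  unfold pvar
  simp only [pexp_affine_permSum k c hy, add_sub_cancel_right, mul_pow, pexp_const_mul,
    pexp_permSum_sq hn ha hy]

lemma pvar_Udiff {n t : ℕ} (hn : 2 ≤ n) (ht : t ≤ n) (R : Fin n → Fin n → ℝ)
    (hsym : ∀ i j, R i j = R j i) :
    pvar n (fun π => Udiff n R π 0 t)
      = (2 * (n - 1)) ^ 2 * (blockVar n t * ∑ i, rowDev n R i ^ 2) := by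
  have hn' : (2 : ℝ) ≤ n := by exact_mod_cast hn
  have hn1 : (n : ℝ) - 1 ≠ 0 := by linarith
  obtain ⟨c, hc⟩ := exists_Udiff_eq (t := t) hn R hsym
  simp only [hc]
  rw [pvar_affine_permSum _ _ hn (sum_centeredInd (by omega) ht) (sum_rowDev (by omega) R),
    sum_centeredInd_sq hn ht]
  field_simp

lemma Zdiff_eq {n t : ℕ} (hn : 2 ≤ n) (ht : t ≤ n) (R : Fin n → Fin n → ℝ)
    (hsym : ∀ i j, R i j = R j i) (π : Equiv.Perm (Fin n)) :
    Zdiff n R π 0 t = (√(blockVar n t))⁻¹ * permSum (centeredInd n t)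
      (fun i => rowDev n R i / √(∑ i, rowDev n R i ^ 2)) π := by
  have hn' : (2 : ℝ) ≤ n := by exact_mod_cast hn
  have hn1 : 0 < 2 * ((n : ℝ) - 1) := by linarith
  have hS : 0 ≤ ∑ i, rowDev n R i ^ 2 := sum_nonneg fun i _ => sq_nonneg _
  have hv := pvar_Udiff hn ht R hsym
  obtain ⟨c, hc⟩ := exists_Udiff_eq (t := t) hn R hsym
  have hp : permSum (centeredInd n t) (fun i => rowDev n R i / √(∑ i, rowDev n R i ^ 2)) π
      = permSum (centeredInd n t) (rowDev n R) π / √(∑ i, rowDev n R i ^ 2) := by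
    simp only [permSum, sum_div, mul_div_assoc]
  unfold Zdiff
  rw [hv, hp, Real.sqrt_mul (sq_nonneg _), Real.sqrt_sq hn1.le, Real.sqrt_mul' _ hS]
  simp only [hc, pexp_affine_permSum _ _ (sum_rowDev (by omega : 0 < n) R), add_sub_cancel_right]
  rw [mul_div_mul_left _ _ hn1.ne', div_eq_mul_inv, div_eq_mul_inv, mul_inv]
  ring

lemma tendsto_floor_div {u : ℝ} (hu : 0 ≤ u) :
    Tendsto (fun n : ℕ => (⌊(n : ℝ) * u⌋₊ : ℝ) / n) atTop (𝓝 u) := by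
  have := (tendsto_nat_floor_mul_div_atTop hu).comp (tendsto_natCast_atTop_atTop (R := ℝ))
  simpa [Function.comp_def, mul_comm] using this

lemma tendsto_inv_sqrt_blockVar {u : ℝ} (hu0 : 0 < u) (hu1 : u < 1) :
    Tendsto (fun n : ℕ => (√(blockVar n ⌊(n : ℝ) * u⌋₊))⁻¹) atTop (𝓝 (√(u * (1 - u)))⁻¹) := by
  have hs : 0 < √(u * (1 - u)) := Real.sqrt_pos.2 (mul_pos hu0 (by linarith))
  refine Tendsto.inv₀ ?_ hs.ne'
  refine (Real.continuous_sqrt.tendsto _).comp ?_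
  have h1 := tendsto_floor_div hu0.le
  have h2 : Tendsto (fun n : ℕ => (1 - 1 / (n : ℝ))⁻¹) atTop (𝓝 (1 - 0)⁻¹) :=
    (tendsto_const_nhds.sub tendsto_one_div_atTop_nhds_zero_nat).inv₀ (by norm_num)
  have h3 := (h1.mul (h1.const_sub 1)).mul h2
  simpa [blockVar] using h3

lemma floor_mul_le {u : ℝ} (hu1 : u < 1) (n : ℕ) : ⌊(n : ℝ) * u⌋₊ ≤ n :=
  Nat.floor_le_of_le (mul_le_of_le_one_right (Nat.cast_nonneg n) hu1.le)

/-- The weights of the linear combination of the standardized statistics. -/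
noncomputable def comboWeight {m : ℕ} (c u : Fin m → ℝ) (n : ℕ) (i : Fin n) : ℝ :=
  ∑ k, c k * (√(blockVar n ⌊(n : ℝ) * u k⌋₊))⁻¹ * centeredInd n ⌊(n : ℝ) * u k⌋₊ i

lemma sum_comboWeight {m : ℕ} (c : Fin m → ℝ) {u : Fin m → ℝ} (hu1 : ∀ k, u k < 1) {n : ℕ}
    (hn : 0 < n) : ∑ i, comboWeight c u n i = 0 := by
  unfold comboWeight
  rw [sum_comm]
  simp only [← mul_sum, sum_centeredInd hn (floor_mul_le (hu1 _) n), mul_zero, sum_const_zero]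

lemma tendsto_sum_comboWeight_sq {m : ℕ} (c u : Fin m → ℝ) (hu0 : ∀ k, 0 < u k)
    (hu1 : ∀ k, u k < 1) :
    Tendsto (fun n => (∑ i, comboWeight c u n i ^ 2) / n) atTop
      (𝓝 (∑ k, ∑ l, c k * c l * rhoDiff (u k) (u l))) := by
  have hlim : Tendsto (fun n : ℕ => ∑ k, ∑ l, c k * c l *
      ((√(blockVar n ⌊(n : ℝ) * u k⌋₊))⁻¹ * (√(blockVar n ⌊(n : ℝ) * u l⌋₊))⁻¹
        * (min ((⌊(n : ℝ) * u k⌋₊ : ℝ) / n) ((⌊(n : ℝ) * u l⌋₊ : ℝ) / n)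
          - (⌊(n : ℝ) * u k⌋₊ : ℝ) / n * ((⌊(n : ℝ) * u l⌋₊ : ℝ) / n)))) atTop
      (𝓝 (∑ k, ∑ l, c k * c l * rhoDiff (u k) (u l))) := by
    refine tendsto_finsetSum _ fun k _ => tendsto_finsetSum _ fun l _ => Tendsto.const_mul _ ?_
    rw [rhoDiff_eq (hu0 k) (hu1 k) (hu0 l) (hu1 l), div_one]
    have hk := tendsto_floor_div (hu0 k).le
    have hl := tendsto_floor_div (hu0 l).le
    exact ((tendsto_inv_sqrt_blockVar (hu0 k) (hu1 k)).mul
      (tendsto_inv_sqrt_blockVar (hu0 l) (hu1 l))).mul ((hk.min hl).sub (hk.mul hl))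
  refine hlim.congr' ?_
  filter_upwards [eventually_gt_atTop 0] with n hn
  have hn0 : (n : ℝ) ≠ 0 := by positivity
  simp only [comboWeight, sq, sum_mul_sum]
  symm
  rw [sum_comm, sum_div]
  refine sum_congr rfl fun k _ => ?_
  rw [sum_comm, sum_div]
  refine sum_congr rfl fun l _ => ?_
  have h := sum_centeredInd_mul hn (floor_mul_le (hu1 k) n) (floor_mul_le (hu1 l) n)
  rw [div_eq_iff hn0]
  symm
  calc _ = c k * c l * ((√(blockVar n ⌊(n : ℝ) * u k⌋₊))⁻¹ * (√(blockVar n ⌊(n : ℝ) * u l⌋₊))⁻¹)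
        * (n * (min ((⌊(n : ℝ) * u k⌋₊ : ℝ) / n) ((⌊(n : ℝ) * u l⌋₊ : ℝ) / n)
          - (⌊(n : ℝ) * u k⌋₊ : ℝ) / n * ((⌊(n : ℝ) * u l⌋₊ : ℝ) / n))) := by ring
    _ = _ := by
      rw [← h, mul_sum]
      exact sum_congr rfl fun i _ => by ring

lemma exists_abs_comboWeight_le {m : ℕ} (c u : Fin m → ℝ) (hu0 : ∀ k, 0 < u k)
    (hu1 : ∀ k, u k < 1) : ∃ K, ∀ᶠ n in atTop, ∀ i, |comboWeight c u n i| ≤ K := by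
  refine ⟨∑ k, |c k| * ((√(u k * (1 - u k)))⁻¹ + 1) * 1, ?_⟩
  have hev : ∀ᶠ n : ℕ in atTop, ∀ k,
      (√(blockVar n ⌊(n : ℝ) * u k⌋₊))⁻¹ < (√(u k * (1 - u k)))⁻¹ + 1 :=
    eventually_all.2 fun k => (tendsto_inv_sqrt_blockVar (hu0 k) (hu1 k)).eventually
      (gt_mem_nhds (lt_add_one _))
  filter_upwards [hev] with n hn i
  refine (abs_sum_le_sum_abs _ _).trans (sum_le_sum fun k _ => ?_)
  rw [abs_mul, abs_mul, abs_of_nonneg (inv_nonneg.2 (Real.sqrt_nonneg _))]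
  gcongr
  · exact (hn k).le
  · exact abs_centeredInd_le (floor_mul_le (hu1 k) n) i

lemma tendsto_sum_abs_cube_normalized {R : (n : ℕ) → Fin n → Fin n → ℝ} (hC2 : Cond2 R) :
    Tendsto (fun n => ∑ i, |rowDev n (R n) i / √(∑ i, rowDev n (R n) i ^ 2)| ^ 3) atTop (𝓝 0) := by
  refine hC2.tendsto_div_nhds_zero.congr' ?_
  filter_upwards [eventually_gt_atTop 0] with n hn
  rw [← sum_rowDev_sq hn]
  have hS : 0 ≤ ∑ i, rowDev n (R n) i ^ 2 := sum_nonneg fun i _ => sq_nonneg _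
  have hpow : (∑ i, rowDev n (R n) i ^ 2) ^ ((3 : ℝ) / 2) = √(∑ i, rowDev n (R n) i ^ 2) ^ 3 := by
    rw [Real.sqrt_eq_rpow, ← Real.rpow_natCast, ← Real.rpow_mul hS]
    norm_num
  rw [hpow, sum_div]
  refine sum_congr rfl fun i _ => ?_
  rw [abs_div, div_pow, abs_of_nonneg (Real.sqrt_nonneg _)]
  rfl

end RING

open RING

/-- Under Conditions (C1)–(C6), for every `m ≥ 1` and `0 < u_1 < … < u_m < 1`,
the vector `(Z_diff^π(⌊n·u_1⌋), …, Z_diff^π(⌊n·u_m⌋))` converges in distribution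
under the permutation null to a centered Gaussian vector with covariance matrix
`C_{ij} = ρ_diff*(u_i,u_j)`, a positive definite matrix with unit diagonal.
Multivariate convergence in distribution is expressed through the Cramér–Wold
device: every linear combination `Σ_i a_i Z_diff^π(⌊n·u_i⌋)` converges in
distribution to `N(0, aᵀCa)`. -/
theorem stmt10 (R : (n : ℕ) → Fin n → Fin n → ℝ)
    (hsym : ∀ n (i j : Fin n), R n i j = R n j i) (hdiag : ∀ n (i : Fin n), R n i i = 0)
    (hC1 : Cond1 R) (hC2 : Cond2 R) (hC3 : Cond3 R) (hC4 : Cond4 R)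
    (hC5 : Cond5 R) (hC6 : Cond6 R)
    (m : ℕ) (hm : 1 ≤ m) (u : Fin m → ℝ) (hmono : StrictMono u)
    (hu0 : ∀ i, 0 < u i) (hu1 : ∀ i, u i < 1)
    (hvar : ∀ i : Fin m, ∀ᶠ n in atTop,
      0 < pvar n (fun π => Uw n (R n) π 0 ⌊(n : ℝ) * u i⌋₊)
      ∧ 0 < pvar n (fun π => Udiff n (R n) π 0 ⌊(n : ℝ) * u i⌋₊)) :
    (Matrix.of fun i j : Fin m => rhoDiff (u i) (u j)).PosDef
    ∧ (∀ i : Fin m, rhoDiff (u i) (u i) = 1)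
    ∧ ∀ a : Fin m → ℝ,
        Tendsto
          (fun n =>
            permDist n (fun π => ∑ i : Fin m, a i * Zdiff n (R n) π 0 ⌊(n : ℝ) * u i⌋₊))
          atTop
          (𝓝 (gaussLimit (∑ i : Fin m, ∑ j : Fin m, a i * a j * rhoDiff (u i) (u j)))) := by
  refine ⟨posDef_rhoDiff u hmono hu0 hu1, fun i => rhoDiff_self (hu0 i) (hu1 i), fun a => ?_⟩
  obtain ⟨K, hK⟩ := exists_abs_comboWeight_le a u hu0 hu1
  have hlim := tendsto_permDist_permSum (comboWeight a u)
    (fun n i => rowDev n (R n) i / √(∑ i, rowDev n (R n) i ^ 2)) K _ ?_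
    (tendsto_sum_abs_cube_normalized hC2) (tendsto_sum_comboWeight_sq a u hu0 hu1)
  · refine hlim.congr' ?_
    filter_upwards [eventually_ge_atTop 2] with n hn
    congr 1
    funext π
    simp only [Zdiff_eq hn (floor_mul_le (hu1 _) n) (R n) (hsym n), permSum, comboWeight,
      sum_mul, mul_sum]
    rw [sum_comm]
    exact sum_congr rfl fun k _ => sum_congr rfl fun i _ => by ring
  · filter_upwards [hK, hvar ⟨0, hm⟩, eventually_ge_atTop 2] with n hKn hv hn
    have hS : 0 < ∑ i, rowDev n (R n) i ^ 2 := by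
      refine lt_of_le_of_ne (sum_nonneg fun i _ => sq_nonneg _) fun h => ?_
      have := hv.2
      rw [pvar_Udiff hn (floor_mul_le (hu1 _) n) (R n) (hsym n), ← h] at this
      simp at this
    refine ⟨sum_comboWeight a hu1 (by omega), ?_, ?_, hKn⟩
    · rw [← sum_div, sum_rowDev (by omega), zero_div]
    · simp only [div_pow, Real.sq_sqrt hS.le]
      rw [← sum_div, div_self hS.ne']
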